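/- In any group G, if A₁ = ξ₁·A₂·ξ₃ and B₁ = ξ₄·B₂·ξ₂ with ξ₁·ξ₂·ξ₃·ξ₄ = 1, then A₁·B₁·A₂⁻¹·B₂⁻¹ is a commutator in G. -/

import Mathlib

/-- Form 3: if `A₁ = ξ₁·A₂·ξ₃` and `B₁ = ξ₄·B₂·ξ₂` with `ξ₁·ξ₂·ξ₃·ξ₄ = 1`, then
`A₁·B₁·A₂⁻¹·B₂⁻¹` is a commutator. -/
theorem form_three_is_commutator (G : Type*) [Group G]
    (A₁ A₂ B₁ B₂ ξ₁ ξ₂ ξ₃ ξ₄ : G)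
    (hA : A₁ = ξ₁ * A₂ * ξ₃) (hB : B₁ = ξ₄ * B₂ * ξ₂)
    (hξ : ξ₁ * ξ₂ * ξ₃ * ξ₄ = 1) :
    ∃ x y : G, A₁ * B₁ * A₂⁻¹ * B₂⁻¹ = x * y * x⁻¹ * y⁻¹ := by
  have h4 : ξ₄ = (ξ₁ * ξ₂ * ξ₃)⁻¹ := eq_inv_of_mul_eq_one_right hξ
  subst hA hB h4
  exact ⟨ξ₁ * A₂ * ξ₂⁻¹ * ξ₁⁻¹, B₂ * ξ₁⁻¹, by group⟩
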